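/- For any countable set {θ_1, θ_2, θ_3, …} of real numbers, the intersection over k ≥ 1 of the sets 𝓑(θ_k) = {η ∈ ℝ : inf over x ∈ ℤ \ {0} of |x| · ‖θ_k x + η‖ > 0} has full Hausdorff dimension in ℝ, i.e. its Hausdorff dimension equals 1. In particular this intersection is nonempty. -/

import Mathlib

/-- Distance from a real number to the nearest integer. -/
noncomputable def dnint (t : ℝ) : ℝ := ⨅ k : ℤ, |t - (k : ℝ)|

/-- In an interval of length `8 (N+1) u`, at most one of the `N+1` candidate children
comes within `u` of a `8 (N+1) u`-separated set. -/
lemma kill_one (N : ℕ) (u : ℝ) (hu : 0 < u) (S : Set ℝ)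
    (hS : ∀ s ∈ S, ∀ s' ∈ S, s ≠ s' → 8 * (N + 1) * u ≤ |s - s'|) (a : ℝ) :
    ∃ t0 : Fin (N + 1), ∀ t : Fin (N + 1), t ≠ t0 → ∀ s ∈ S, ∀ η : ℝ,
      a + 4 * (t : ℕ) * u ≤ η → η ≤ a + 4 * (t : ℕ) * u + u → u ≤ |η - s| := by
  by_contra hcon
  push Not at hcon
  obtain ⟨t0, -, s0, hs0, η0, h01, h02, h03⟩ := hcon 0
  obtain ⟨t, ht, s, hs, η, h1, h2, h3⟩ := hcon t0
  have hNu : 0 ≤ (N : ℝ) * u := by positivity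
  have htN : ((t : ℕ) : ℝ) * u ≤ N * u := by
    have : ((t : ℕ) : ℝ) ≤ N := by exact_mod_cast Nat.lt_succ_iff.1 t.2
    gcongr
  have htN0 : ((t0 : ℕ) : ℝ) * u ≤ N * u := by
    have : ((t0 : ℕ) : ℝ) ≤ N := by exact_mod_cast Nat.lt_succ_iff.1 t0.2
    gcongr
  have ht0 : 0 ≤ ((t : ℕ) : ℝ) * u := by positivity
  have ht00 : 0 ≤ ((t0 : ℕ) : ℝ) * u := by positivity
  rw [abs_lt] at h03 h3
  have hss : s = s0 := by
    by_contra hne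
    have := hS s hs s0 hs0 hne
    have h4 : |s - s0| < 8 * (N + 1) * u := by
      rw [abs_lt]
      constructor <;> nlinarith
    linarith
  subst hss
  have hne : (t : ℕ) ≠ (t0 : ℕ) := fun h => ht (Fin.ext h)
  rcases lt_or_gt_of_ne hne with h | h
  · have h5 : ((t : ℕ) : ℝ) + 1 ≤ ((t0 : ℕ) : ℝ) := by exact_mod_cast h
    nlinarith [mul_le_mul_of_nonneg_right h5 hu.le]
  · have h5 : ((t0 : ℕ) : ℝ) + 1 ≤ ((t : ℕ) : ℝ) := by exact_mod_cast h
    nlinarith [mul_le_mul_of_nonneg_right h5 hu.le]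

/-- Left endpoints of the nested intervals of the Cantor construction. -/
noncomputable def cantorLeft (N : ℕ) (t0 : ℕ → ℝ → Fin (N + 1)) (w : ℕ → Fin N) : ℕ → ℝ
  | 0 => 0
  | m + 1 => cantorLeft N t0 w m +
      4 * (((t0 m (cantorLeft N t0 w m)).succAbove (w m) : Fin (N + 1)) : ℕ) *
        ((8 * (N + 1) : ℝ) ^ (m + 1))⁻¹

lemma cantorLeft_congr (N : ℕ) (t0 : ℕ → ℝ → Fin (N + 1)) (w w' : ℕ → Fin N) (m : ℕ)
    (h : ∀ i < m, w i = w' i) : cantorLeft N t0 w m = cantorLeft N t0 w' m := by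
  induction m with
  | zero => rfl
  | succ m ih =>
    rw [cantorLeft, cantorLeft, ih fun i hi => h i (by omega), h m (by omega)]

lemma cantor_point (N : ℕ) (t0 : ℕ → ℝ → Fin (N + 1)) (w : ℕ → Fin N) :
    ∃ x : ℝ, ∀ m, cantorLeft N t0 w m ≤ x ∧
      x ≤ cantorLeft N t0 w m + ((8 * (N + 1) : ℝ) ^ m)⁻¹ := by
  have hpow : ∀ m : ℕ, ((8 * (N + 1) : ℝ) ^ m)⁻¹ =
      8 * (N + 1) * ((8 * (N + 1) : ℝ) ^ (m + 1))⁻¹ := by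
    intro m
    have : (8 * (N + 1) : ℝ) ≠ 0 := by positivity
    rw [pow_succ]
    field_simp
  have h1 : Monotone (cantorLeft N t0 w) := by
    apply monotone_nat_of_le_succ
    intro m
    rw [cantorLeft]
    have : (0 : ℝ) ≤ 4 * (((t0 m (cantorLeft N t0 w m)).succAbove (w m) : Fin (N + 1)) : ℕ) *
        ((8 * (N + 1) : ℝ) ^ (m + 1))⁻¹ := by positivity
    linarith
  have h2 : Antitone fun m => cantorLeft N t0 w m + ((8 * (N + 1) : ℝ) ^ m)⁻¹ := by
    apply antitone_nat_of_succ_le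
    intro m
    rw [cantorLeft, hpow m]
    generalize (t0 m (cantorLeft N t0 w m)).succAbove (w m) = t
    have hu : (0 : ℝ) < ((8 * (N + 1) : ℝ) ^ (m + 1))⁻¹ := by positivity
    generalize ((8 * (N + 1) : ℝ) ^ (m + 1))⁻¹ = u at hu ⊢
    have htN : ((t : ℕ) : ℝ) * u ≤ N * u := by
      have : ((t : ℕ) : ℝ) ≤ N := by exact_mod_cast Nat.lt_succ_iff.1 t.2
      gcongr
    have hNu : 0 ≤ (N : ℝ) * u := by positivity
    nlinarith
  have h3 : cantorLeft N t0 w ≤ fun m => cantorLeft N t0 w m + ((8 * (N + 1) : ℝ) ^ m)⁻¹ := by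
    intro m
    have : (0 : ℝ) ≤ ((8 * (N + 1) : ℝ) ^ m)⁻¹ := by positivity
    simpa using this
  have := h1.ciSup_mem_iInter_Icc_of_antitone h2 h3
  rw [Set.mem_iInter] at this
  exact ⟨_, fun m => this m⟩

theorem cantor_dim (N : ℕ) (hN : 1 < N) (S : ℕ → Set ℝ)
    (hS : ∀ m, ∀ s ∈ S m, ∀ s' ∈ S m, s ≠ s' → ((8 * (N + 1) : ℝ) ^ m)⁻¹ ≤ |s - s'|)
    (r : NNReal) (hr : 0 < r) (hrN : (8 * (N + 1) : ℝ) ^ (r : ℝ) ≤ N) :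
    (r : ENNReal) ≤
      dimH {η : ℝ | ∀ m, ∀ s ∈ S m, ((8 * (N + 1) : ℝ) ^ (m + 1))⁻¹ ≤ |η - s|} := by
  set M : ℝ := 8 * (N + 1) with hM
  have hM0 : 0 < M := by positivity
  have hkill : ∀ (m : ℕ) (a : ℝ), ∃ t0 : Fin (N + 1), ∀ t : Fin (N + 1), t ≠ t0 → ∀ s ∈ S m,
      ∀ η : ℝ, a + 4 * (t : ℕ) * (M ^ (m + 1))⁻¹ ≤ η →
      η ≤ a + 4 * (t : ℕ) * (M ^ (m + 1))⁻¹ + (M ^ (m + 1))⁻¹ →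
      (M ^ (m + 1))⁻¹ ≤ |η - s| := by
    intro m a
    refine kill_one N _ (by positivity) (S m) ?_ a
    intro s hs s' hs' hne
    have := hS m s hs s' hs' hne
    have h2 : 8 * (N + 1) * (M ^ (m + 1))⁻¹ = (M ^ m)⁻¹ := by
      rw [← hM, pow_succ]; field_simp
    rwa [h2]
  choose t0 ht0 using hkill
  choose x hx using cantor_point N t0
  have hxE : ∀ w, x w ∈ {η : ℝ | ∀ m, ∀ s ∈ S m, (M ^ (m + 1))⁻¹ ≤ |η - s|} := by
    intro w m s hs
    have := hx w (m + 1)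
    rw [cantorLeft] at this
    exact ht0 m _ _ (Fin.succAbove_ne _ _) s hs _ this.1 this.2
  have hdist : ∀ w w', |Real.ofDigits w - Real.ofDigits w'| ≤ N * |x w - x w'| ^ (r : ℝ) := by
    intro w w'
    by_cases hww : w = w'
    · subst hww
      simp only [sub_self, abs_zero]
      positivity
    have hex : ∃ m, w m ≠ w' m := by
      by_contra h
      push Not at h
      exact hww (funext h)
    classical
    let m := Nat.find hex
    have hm : w m ≠ w' m := Nat.find_spec hex
    have hlt : ∀ i < m, w i = w' i := fun i hi => by
      by_contra h
      exact Nat.find_min hex hi h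
    have hy := Real.abs_ofDigits_sub_ofDigits_le hlt
    have h1 := hx w (m + 1)
    have h2 := hx w' (m + 1)
    rw [cantorLeft] at h1 h2
    rw [← cantorLeft_congr N t0 w w' m hlt] at h2
    have hne : (t0 m (cantorLeft N t0 w m)).succAbove (w m) ≠
        (t0 m (cantorLeft N t0 w m)).succAbove (w' m) :=
      fun h => hm (Fin.succAbove_right_injective h)
    rw [← hM] at h1 h2
    have hxx : (M ^ (m + 1))⁻¹ ≤ |x w - x w'| := by
      generalize (t0 m (cantorLeft N t0 w m)).succAbove (w m) = t at *
      generalize (t0 m (cantorLeft N t0 w m)).succAbove (w' m) = t' at *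
      have hu : 0 < (M ^ (m + 1))⁻¹ := by positivity
      generalize (M ^ (m + 1))⁻¹ = u at *
      have hne : (t : ℕ) ≠ (t' : ℕ) := fun h => hne (Fin.ext h)
      rcases lt_or_gt_of_ne hne with h | h
      · have h5 : ((t : ℕ) : ℝ) + 1 ≤ ((t' : ℕ) : ℝ) := by exact_mod_cast h
        have := mul_le_mul_of_nonneg_right h5 hu.le
        rw [abs_sub_comm]
        refine le_trans ?_ (le_abs_self _)
        linarith
      · have h5 : ((t' : ℕ) : ℝ) + 1 ≤ ((t : ℕ) : ℝ) := by exact_mod_cast h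
        have := mul_le_mul_of_nonneg_right h5 hu.le
        refine le_trans ?_ (le_abs_self _)
        linarith
    have hN0 : (0 : ℝ) < N := by exact_mod_cast (by omega : 0 < N)
    refine hy.trans ?_
    calc ((N : ℝ) ^ m)⁻¹ = N * ((N : ℝ) ^ (m + 1))⁻¹ := by rw [pow_succ]; field_simp
      _ ≤ N * ((M ^ (r : ℝ)) ^ (m + 1))⁻¹ := by
        gcongr
      _ = N * ((M ^ (m + 1))⁻¹) ^ (r : ℝ) := by
        congr 1
        rw [Real.inv_rpow (by positivity), ← Real.rpow_natCast, ← Real.rpow_natCast,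
          ← Real.rpow_mul hM0.le, ← Real.rpow_mul hM0.le, mul_comm]
      _ ≤ N * |x w - x w'| ^ (r : ℝ) := by gcongr
  have : Nonempty (ℕ → Fin N) := ⟨fun _ => ⟨0, by omega⟩⟩
  let f : ℝ → ℝ := fun y => Real.ofDigits (Function.invFun x y)
  have hf : ∀ w, f (x w) = Real.ofDigits w := by
    intro w
    have h1 : x (Function.invFun x (x w)) = x w := Function.invFun_eq ⟨w, rfl⟩
    have h2 := hdist (Function.invFun x (x w)) w
    rw [h1, sub_self, abs_zero, Real.zero_rpow (by positivity), mul_zero] at h2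
    have := abs_nonpos_iff.1 h2
    simp only [f]
    linarith
  have hHol : HolderOnWith (N : NNReal) r f (Set.range x) := by
    rintro _ ⟨w, rfl⟩ _ ⟨w', rfl⟩
    rw [hf, hf, edist_dist, edist_dist, Real.dist_eq, Real.dist_eq,
      ENNReal.ofReal_rpow_of_nonneg (abs_nonneg _) r.coe_nonneg]
    calc ENNReal.ofReal |Real.ofDigits w - Real.ofDigits w'|
        ≤ ENNReal.ofReal (N * |x w - x w'| ^ (r : ℝ)) := ENNReal.ofReal_le_ofReal (hdist w w')
      _ = _ := by
        rw [ENNReal.ofReal_mul (by positivity)]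
        simp
  have hdim := hHol.dimH_image_le hr
  have hsub : Set.Icc (0 : ℝ) 1 ⊆ f '' Set.range x := by
    intro y hy
    obtain ⟨w, -, hw⟩ := Real.ofDigits_SurjOn hN hy
    exact ⟨x w, ⟨w, rfl⟩, by rw [hf, hw]⟩
  have hone : dimH (Set.Icc (0 : ℝ) 1) = 1 := by
    rw [Real.dimH_of_nonempty_interior (by rw [interior_Icc]; exact ⟨1 / 2, by norm_num⟩)]
    simp
  have h3 : (1 : ENNReal) ≤ dimH (Set.range x) / r := by
    rw [← hone]
    exact (dimH_mono hsub).trans hdim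
  have h4 : (r : ENNReal) ≤ dimH (Set.range x) := by
    have := (ENNReal.le_div_iff_mul_le (Or.inl (by exact_mod_cast hr.ne'))
      (Or.inl ENNReal.coe_ne_top)).1 h3
    simpa using this
  refine h4.trans (dimH_mono ?_)
  rintro _ ⟨w, rfl⟩
  exact hxE w

/-- `q` is the denominator of a best approximation to `θ`. -/
def IsGoodDen (θ : ℝ) (q : ℕ) : Prop :=
  0 < q ∧ ∀ t : ℕ, 0 < t → t < q → ∀ k : ℤ,
    |(q : ℝ) * θ - round ((q : ℝ) * θ)| < |(t : ℝ) * θ - k|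

lemma good_sep (θ : ℝ) (q : ℕ) (hq : IsGoodDen θ q) (t : ℕ) (ht : 0 < t) (htq : t < q) (k : ℤ) :
    1 / (2 * q : ℝ) ≤ |(t : ℝ) * θ - k| := by
  by_contra hcon
  push Not at hcon
  have hg := hq.2 t ht htq k
  generalize round ((q : ℝ) * θ) = p at hg
  have hq0 : (0 : ℝ) < q := by exact_mod_cast hq.1
  have ht0 : (0 : ℝ) < t := by exact_mod_cast ht
  have htq' : (t : ℝ) < q := by exact_mod_cast htq
  have h1 : (q : ℝ) * |(t : ℝ) * θ - k| < 1 / 2 := by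
    calc (q : ℝ) * |(t : ℝ) * θ - k| < q * (1 / (2 * q : ℝ)) := by gcongr
      _ = 1 / 2 := by field_simp
  have h2 : (t : ℝ) * |(q : ℝ) * θ - p| ≤ (q : ℝ) * |(t : ℝ) * θ - k| := by gcongr
  have hD : ((t * p - q * k : ℤ) : ℝ) = q * (t * θ - k) - t * (q * θ - p) := by
    push_cast; ring
  have hlt : |((t * p - q * k : ℤ) : ℝ)| < 1 := by
    rw [hD]
    calc |q * (t * θ - k) - t * (q * θ - p)| ≤ |q * (t * θ - k)| + |t * (q * θ - p)| :=
          abs_sub _ _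
      _ = q * |t * θ - k| + t * |q * θ - p| := by
          rw [abs_mul, abs_mul, abs_of_pos hq0, abs_of_pos ht0]
      _ < 1 := by linarith
  have hz : (t * p - q * k : ℤ) = 0 := by
    rw [← Int.abs_lt_one_iff]
    exact_mod_cast hlt
  rw [hz, Int.cast_zero] at hD
  have h3 : (q : ℝ) * |(t : ℝ) * θ - k| = t * |(q : ℝ) * θ - p| := by
    have : q * (t * θ - k) = t * (q * θ - p) := by linarith
    rw [← abs_of_pos hq0, ← abs_of_pos ht0, ← abs_mul, ← abs_mul, abs_of_pos hq0,
      abs_of_pos ht0, this]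
  have h4 : (t : ℝ) * |(q : ℝ) * θ - p| ≤ q * |(q : ℝ) * θ - p| := by gcongr
  have h5 : (q : ℝ) * |(q : ℝ) * θ - p| < q * |(t : ℝ) * θ - k| := by gcongr
  linarith

lemma good_exists (θ : ℝ) (X : ℕ) (hX : 0 < X) :
    ∃ q : ℕ, q ≤ X ∧ IsGoodDen θ q ∧ |(q : ℝ) * θ - round ((q : ℝ) * θ)| ≤ 1 / (X + 1) := by
  classical
  obtain ⟨t1, ht1, ht1X, ht1'⟩ := Real.exists_nat_abs_mul_sub_round_le θ hX
  let nn : ℕ → ℝ := fun t => |(t : ℝ) * θ - round ((t : ℝ) * θ)|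
  have hex : ∃ q : ℕ, 0 < q ∧ q ≤ X ∧ ∀ t : ℕ, 0 < t → t ≤ X → nn q ≤ nn t := by
    obtain ⟨q, hq, hmin⟩ := Finset.exists_min_image (Finset.Icc 1 X) nn
      ⟨1, Finset.mem_Icc.2 ⟨le_rfl, hX⟩⟩
    rw [Finset.mem_Icc] at hq
    exact ⟨q, hq.1, hq.2, fun t ht htX => hmin t (Finset.mem_Icc.2 ⟨ht, htX⟩)⟩
  obtain ⟨hq0, hqX, hqmin⟩ := Nat.find_spec hex
  refine ⟨Nat.find hex, hqX, ⟨hq0, ?_⟩, (hqmin t1 ht1 ht1X).trans ht1'⟩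
  intro t ht htq k
  have := Nat.find_min hex htq
  push Not at this
  obtain ⟨t', ht', ht'X, hlt⟩ := this ht (by omega)
  calc _ ≤ nn t' := hqmin t' ht' ht'X
    _ < nn t := hlt
    _ ≤ _ := round_le _ _

lemma bad_of_good (θ η c : ℝ) (hc : 0 < c)
    (h : ∀ q : ℕ, IsGoodDen θ q → ∀ x : ℕ, x < q → ∀ k : ℤ, c / q ≤ |η - (k - θ * x)|) :
    ∃ c' : ℝ, 0 < c' ∧ ∀ x : ℕ, 0 < x → ∀ k : ℤ, c' / x ≤ |θ * x + η - k| := by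
  obtain ⟨K, hK⟩ := exists_nat_ge (max (2 / c) 1)
  have hK2 : 2 / c ≤ K := (le_max_left _ _).trans hK
  have hK1 : (1 : ℝ) ≤ K := (le_max_right _ _).trans hK
  have hK0 : 0 < K := by exact_mod_cast lt_of_lt_of_le one_pos hK1
  refine ⟨min (c / K) (c / 2), by positivity, ?_⟩
  intro x hx k
  have hx0 : (0 : ℝ) < x := by exact_mod_cast hx
  obtain ⟨q, hqX, hq, hqn⟩ := good_exists θ (K * x) (by positivity)
  have hq0 : (0 : ℝ) < q := by exact_mod_cast hq.1
  rcases lt_or_ge x q with hxq | hxq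
  · have h1 := h q hq x hxq k
    have hqX' : (q : ℝ) ≤ K * x := by exact_mod_cast hqX
    calc min (c / K) (c / 2) / x ≤ (c / K) / x := by gcongr; exact min_le_left _ _
      _ = c / (K * x) := by rw [div_div]
      _ ≤ c / q := by gcongr
      _ ≤ _ := h1
      _ = _ := by congr 1; ring
  · have h1 := h q hq (x % q) (Nat.mod_lt _ hq.1) (k - (x / q : ℕ) * round ((q : ℝ) * θ))
    generalize round ((q : ℝ) * θ) = p at *
    have hxe : (x : ℝ) = q * (x / q : ℕ) + (x % q : ℕ) := by
      exact_mod_cast (Nat.div_add_mod x q).symm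
    have hj : ((x / q : ℕ) : ℝ) ≤ x / q := Nat.cast_div_le
    have hxq' : (q : ℝ) ≤ x := by exact_mod_cast hxq
    generalize (x / q : ℕ) = j at *
    generalize (x % q : ℕ) = r at *
    have h2 : |(j : ℝ) * (q * θ - p)| ≤ (c / 2) / q := by
      rw [abs_mul, abs_of_nonneg (by positivity : (0 : ℝ) ≤ j)]
      calc (j : ℝ) * |(q : ℝ) * θ - p| ≤ (x / q) * (1 / (((K * x : ℕ) : ℝ) + 1)) := by gcongr
        _ ≤ (x / q) * (1 / (K * x)) := by
          push_cast
          gcongr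
          linarith
        _ = (1 / K) / q := by field_simp
        _ ≤ (c / 2) / q := by
          rw [div_le_iff₀ hc] at hK2
          have h6 : (1 : ℝ) / K ≤ c / 2 := by
            rw [div_le_div_iff₀ (by positivity) (by positivity)]
            linarith
          exact div_le_div_of_nonneg_right h6 hq0.le
    have h3 : η - (((k - (j : ℕ) * p : ℤ) : ℝ) - θ * r) =
        (θ * x + η - k) - (j : ℝ) * (q * θ - p) := by
      rw [hxe]; push_cast; ring
    rw [h3] at h1
    have h4 := abs_sub (θ * x + η - k) ((j : ℝ) * (q * θ - p))
    have h5 : c / q = (c / 2) / q + (c / 2) / q := by ring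
    calc min (c / K) (c / 2) / x ≤ (c / 2) / x := by gcongr; exact min_le_right _ _
      _ ≤ (c / 2) / q := by gcongr
      _ ≤ _ := by linarith

/-- The points to avoid, at scale `A`. -/
def dangerSet (θ A : ℝ) : Set ℝ :=
  {s | ∃ q : ℕ, IsGoodDen θ q ∧ 2 * (q : ℝ) ≤ A ∧ ∃ x : ℕ, x < q ∧ ∃ k : ℤ, s = k - θ * x}

lemma danger_sep_aux (θ A : ℝ) (q : ℕ) (hq : IsGoodDen θ q) (hA : 2 * (q : ℝ) ≤ A)
    (x x' : ℕ) (hx : x < q) (hxx : x' ≤ x) (k k' : ℤ)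
    (hne : (k - θ * x : ℝ) ≠ k' - θ * x') : A⁻¹ ≤ |(k - θ * x : ℝ) - (k' - θ * x')| := by
  have hq1 : (1 : ℝ) ≤ q := by exact_mod_cast hq.1
  have hA' : A⁻¹ ≤ 1 / (2 * q : ℝ) := by
    rw [← one_div]
    gcongr
  refine hA'.trans ?_
  rcases hxx.eq_or_lt with h | h
  · subst h
    have h1 : (k - θ * x' : ℝ) - (k' - θ * x') = ((k - k' : ℤ) : ℝ) := by push_cast; ring
    have h2 : k - k' ≠ 0 := by
      intro h0
      apply hne
      have : k = k' := by omega
      rw [this]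
    rw [h1]
    have h3 : (1 : ℝ) ≤ |((k - k' : ℤ) : ℝ)| := by
      exact_mod_cast Int.one_le_abs h2
    refine le_trans ?_ h3
    rw [div_le_one (by positivity)]
    linarith
  · have := good_sep θ q hq (x - x') (by omega) (by omega) (k - k')
    rw [Nat.cast_sub hxx] at this
    rw [abs_sub_comm]
    have h1 : (k' - θ * x' : ℝ) - (k - θ * x) = (x - x') * θ - ((k - k' : ℤ) : ℝ) := by
      push_cast; ring
    rw [h1]
    exact this

lemma danger_sep (θ A : ℝ) (s : ℝ) (hs : s ∈ dangerSet θ A) (s' : ℝ)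
    (hs' : s' ∈ dangerSet θ A) (hne : s ≠ s') : A⁻¹ ≤ |s - s'| := by
  obtain ⟨q, hq, hqA, x, hx, k, rfl⟩ := hs
  obtain ⟨q', hq', hqA', x', hx', k', rfl⟩ := hs'
  rcases le_total x' x with h | h
  · exact danger_sep_aux θ A q hq hqA x x' hx h k k' hne
  · rw [abs_sub_comm]
    exact danger_sep_aux θ A q' hq' hqA' x' x hx' h k' k hne.symm

lemma schedule : ∃ σ : ℕ → ℕ, ∀ i, ∃ B, ∀ a, ∃ m, a ≤ m ∧ m ≤ a + B ∧ σ m = i := by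
  refine ⟨padicValNat 2, fun i => ⟨2 ^ (i + 1) + 2 ^ i, fun a => ?_⟩⟩
  refine ⟨2 ^ i * (2 * (a / 2 ^ (i + 1) + 1) + 1), ?_, ?_, ?_⟩
  · have := Nat.div_add_mod a (2 ^ (i + 1))
    have h2 := Nat.mod_lt a (by positivity : 0 < 2 ^ (i + 1))
    rw [pow_succ] at *
    generalize a / (2 ^ i * 2) = d at *
    have h3 : 2 ^ i * (2 * (d + 1) + 1) = 2 ^ i * 2 * d + 2 ^ i * 2 + 2 ^ i := by ring
    omega
  · have := Nat.div_add_mod a (2 ^ (i + 1))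
    rw [pow_succ] at *
    generalize a / (2 ^ i * 2) = d at *
    have h3 : 2 ^ i * (2 * (d + 1) + 1) = 2 ^ i * 2 * d + 2 ^ i * 2 + 2 ^ i := by ring
    omega
  · rw [padicValNat.mul (by positivity) (by positivity), padicValNat.prime_pow,
      padicValNat.eq_zero_of_not_dvd (by omega)]
    rfl

/-- Lower bound for the dimension of the set of simultaneously (one-sided) bad points. -/
lemma dim_bad_ge (ψ : ℕ → ℝ) (N : ℕ) (hN : 1 < N) (r : NNReal) (hr : 0 < r)
    (hrN : (8 * (N + 1) : ℝ) ^ (r : ℝ) ≤ N) :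
    (r : ENNReal) ≤ dimH {η : ℝ | ∀ i, ∃ c' : ℝ, 0 < c' ∧ ∀ x : ℕ, 0 < x → ∀ k : ℤ,
      c' / x ≤ |ψ i * x + η - k|} := by
  obtain ⟨σ, hσ⟩ := schedule
  refine (cantor_dim N hN (fun m => dangerSet (ψ (σ m)) ((8 * (N + 1) : ℝ) ^ m))
    (fun m => danger_sep _ _) r hr hrN).trans (dimH_mono ?_)
  intro η hη i
  obtain ⟨B, hB⟩ := hσ i
  have hM1 : (1 : ℝ) ≤ 8 * (N + 1) := by
    have : (0 : ℝ) ≤ N := by positivity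
    linarith
  refine bad_of_good (ψ i) η (1 / (2 * (8 * (N + 1) : ℝ) ^ (B + 2))) (by positivity) ?_
  intro q hq x hx k
  have hq0 : (0 : ℝ) < q := by exact_mod_cast hq.1
  set a := Nat.log (8 * (N + 1)) (2 * q) with ha
  obtain ⟨m, hm1, hm2, hm3⟩ := hB (a + 1)
  have h1 : (2 * q : ℝ) ≤ (8 * (N + 1) : ℝ) ^ m := by
    have h2 : 2 * q < (8 * (N + 1)) ^ (a + 1) := Nat.lt_pow_succ_log_self (by omega) _
    have h3 : (2 * q : ℝ) < (8 * (N + 1) : ℝ) ^ (a + 1) := by exact_mod_cast h2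
    exact h3.le.trans (pow_le_pow_right₀ hM1 hm1)
  have h4 : (8 * (N + 1) : ℝ) ^ a ≤ 2 * q := by
    have h2 : (8 * (N + 1)) ^ a ≤ 2 * q := Nat.pow_log_le_self _ (by have := hq.1; omega)
    exact_mod_cast h2
  have h5 := hη m (k - ψ i * x) (by rw [hm3]; exact ⟨q, hq, h1, x, hx, k, rfl⟩)
  refine le_trans ?_ h5
  rw [div_div, ← one_div]
  apply one_div_le_one_div_of_le (by positivity)
  calc (8 * (N + 1) : ℝ) ^ (m + 1) ≤ (8 * (N + 1) : ℝ) ^ (a + (B + 2)) :=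
        pow_le_pow_right₀ hM1 (by omega)
    _ = (8 * (N + 1) : ℝ) ^ a * (8 * (N + 1) : ℝ) ^ (B + 2) := pow_add _ _ _
    _ ≤ (2 * q) * (8 * (N + 1) : ℝ) ^ (B + 2) := by gcongr
    _ = _ := by ring

lemma exists_N (r : ℝ) (hr1 : r < 1) :
    ∃ N : ℕ, 1 < N ∧ (8 * (N + 1) : ℝ) ^ r ≤ N := by
  -- `(16 N)^r ≤ N` as soon as `16 ^ r ≤ N ^ (1 - r)`
  have ht := (tendsto_rpow_atTop (by linarith : 0 < 1 - r)).comp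
    (tendsto_natCast_atTop_atTop (R := ℝ))
  obtain ⟨N, hN1, hN2⟩ := ((ht.eventually_ge_atTop ((16 : ℝ) ^ |r|)).and
    (Filter.eventually_gt_atTop 1)).exists
  refine ⟨N, hN2, ?_⟩
  have hN : (1 : ℝ) < N := by exact_mod_cast hN2
  simp only [Function.comp] at hN1
  rcases le_or_gt r 0 with h0 | h0
  · refine le_trans (Real.rpow_le_one_of_one_le_of_nonpos (by linarith) h0) hN.le
  rw [abs_of_pos h0] at hN1
  calc (8 * (N + 1) : ℝ) ^ r ≤ (16 * N : ℝ) ^ r :=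
        Real.rpow_le_rpow (by positivity) (by linarith) h0.le
    _ = 16 ^ r * (N : ℝ) ^ r := Real.mul_rpow (by norm_num) (by positivity)
    _ ≤ (N : ℝ) ^ (1 - r) * (N : ℝ) ^ r := by gcongr
    _ = N := by rw [← Real.rpow_add (by linarith)]; simp

lemma dim_bad (ψ : ℕ → ℝ) :
    1 ≤ dimH {η : ℝ | ∀ i, ∃ c' : ℝ, 0 < c' ∧ ∀ x : ℕ, 0 < x → ∀ k : ℤ,
      c' / x ≤ |ψ i * x + η - k|} := by
  refine le_of_forall_lt fun b hb => ?_
  obtain ⟨r, hbr, hr1⟩ := ENNReal.lt_iff_exists_nnreal_btwn.1 hb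
  have hr1' : (r : ℝ) < 1 := by exact_mod_cast hr1
  have hr0 : 0 < r := by
    have : (0 : ENNReal) < r := lt_of_le_of_lt zero_le hbr
    exact_mod_cast this
  obtain ⟨N, hN, hrN⟩ := exists_N r hr1'
  exact hbr.trans_le (dim_bad_ge ψ N hN r hr0 hrN)

lemma bad_subset (θ : ℕ → ℝ) :
    {η : ℝ | ∀ i, ∃ c' : ℝ, 0 < c' ∧ ∀ x : ℕ, 0 < x → ∀ k : ℤ,
      c' / x ≤ |(if i % 2 = 0 then θ (i / 2) else -θ (i / 2)) * x + η - k|} ⊆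
    (⋂ k : ℕ, {η : ℝ |
        0 < ⨅ x : {x : ℤ // x ≠ 0}, (|x.val| : ℝ) * dnint (θ k * (x.val : ℝ) + η)}) := by
  intro η hη
  rw [Set.mem_iInter]
  intro i
  obtain ⟨c1, hc1, h1⟩ := hη (2 * i)
  obtain ⟨c2, hc2, h2⟩ := hη (2 * i + 1)
  simp only [show 2 * i % 2 = 0 by omega, show 2 * i / 2 = i by omega, if_true] at h1
  simp only [show (2 * i + 1) % 2 = 1 by omega, show (2 * i + 1) / 2 = i by omega,
    one_ne_zero, if_false] at h2
  change 0 < ⨅ x : {x : ℤ // x ≠ 0}, (|x.val| : ℝ) * dnint (θ i * (x.val : ℝ) + η)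
  have : Nonempty {x : ℤ // x ≠ 0} := ⟨⟨1, one_ne_zero⟩⟩
  refine lt_of_lt_of_le (lt_min hc1 hc2) (le_ciInf ?_)
  rintro ⟨x, hx⟩
  have hx0 : (0 : ℝ) < |(x : ℝ)| := abs_pos.2 (by exact_mod_cast hx)
  have hn : ((x.natAbs : ℕ) : ℝ) = |(x : ℝ)| := by
    rw [Nat.cast_natAbs, Int.cast_abs]
  have hpos : 0 < x.natAbs := Int.natAbs_pos.2 hx
  have key : min c1 c2 / |(x : ℝ)| ≤ dnint (θ i * (x : ℝ) + η) := by
    refine le_ciInf fun k => ?_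
    rcases lt_or_gt_of_ne hx with h | h
    · have h3 := h2 x.natAbs hpos k
      have h' : (x : ℝ) < 0 := by exact_mod_cast h
      rw [hn] at h3
      refine le_trans (by gcongr; exact min_le_right _ _) (h3.trans (le_of_eq ?_))
      rw [abs_of_neg h']
      congr 1
      ring
    · have h3 := h1 x.natAbs hpos k
      have h' : (0 : ℝ) < x := by exact_mod_cast h
      rw [hn] at h3
      refine le_trans (by gcongr; exact min_le_left _ _) (h3.trans (le_of_eq ?_))
      rw [abs_of_pos h']
  rw [div_le_iff₀ hx0] at key
  simp only
  linarith

/-- For a countable set of reals `θ_k`, the intersection of the sets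
`𝓑(θ_k) = {η : inf_{x ∈ ℤ \ {0}} |x| ⬝ ‖θ_k x + η‖ > 0}` has full Hausdorff
dimension `1`; in particular it is nonempty. -/
theorem countable_intersection_bad_full_dimension (θ : ℕ → ℝ) :
    dimH (⋂ k : ℕ, {η : ℝ |
        0 < ⨅ x : {x : ℤ // x ≠ 0}, (|x.val| : ℝ) * dnint (θ k * (x.val : ℝ) + η)}) = 1 ∧
    (⋂ k : ℕ, {η : ℝ |
        0 < ⨅ x : {x : ℤ // x ≠ 0}, (|x.val| : ℝ) * dnint (θ k * (x.val : ℝ) + η)}).Nonempty := by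
  have hdim : dimH (⋂ k : ℕ, {η : ℝ |
      0 < ⨅ x : {x : ℤ // x ≠ 0}, (|x.val| : ℝ) * dnint (θ k * (x.val : ℝ) + η)}) = 1 := by
    apply le_antisymm
    · rw [← Real.dimH_univ]
      exact dimH_mono (Set.subset_univ _)
    · exact (dim_bad _).trans (dimH_mono (bad_subset θ))
  refine ⟨hdim, ?_⟩
  rw [Set.nonempty_iff_ne_empty]
  intro h
  rw [h, dimH_empty] at hdim
  exact zero_ne_one hdim
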